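/- arXiv:math/0603116 — 4 statements merged into one kernel-verified Lean document; each statement's English description precedes it below -/
import Mathlib

section
/- Fix V ∈ ℕ. The vector t ∈ ℝ^{2^{X_0}} defined by t({x_{u,r} : u ≥ v, r ∈ {−1,1}}) = t({x_{u,r} : u < v, r ∈ {−1,1}}) = 1 for each v ∈ [1,V+1], t({x_{v,s}}) = t(X_0 ∖ {x_{v,s}}) = 10^{v+(s+1)/2} for every (v,s) with v ∈ [0,V+1], s ∈ {−1,1}, (v,s) ≠ (0,−1), t({x_{0,−1}}) = t(X_0 ∖ {x_{0,−1}}) = 0, and t(S) = 0 for all other subsets S ⊆ X_0, is a tree realization of the midpoints structure m_0. -/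
open Classical

/-- `sel S e` is `S¹ = S` for `e = true` and `Sᶜ = X∖S` for `e = false`. -/
def sel {X : Type*} (S : Set X) (e : Bool) : Set X := if e then S else Sᶜ

/-- The closed interval `[S,T] = {U ⊆ X | S^e ⊆ U^g ⊆ T^f for some e, f, g ∈ {1,c}}`. -/
def icc {X : Type*} (S T : Set X) : Set (Set X) :=
  {U | ∃ e f g : Bool, sel S e ⊆ sel U g ∧ sel U g ⊆ sel T f}

/-- The half-open interval `[S,T) = [S,T] ∖ {T}`. -/
def ico {X : Type*} (S T : Set X) : Set (Set X) := icc S T \ {T}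

/-- The open interval `(S,T) = [S,T] ∖ {S, Sᶜ, T, Tᶜ}`. -/
def ioo {X : Type*} (S T : Set X) : Set (Set X) := icc S T \ {S, Sᶜ, T, Tᶜ}

/-- `t_W = Σ_{S ∈ W} t(S)` for a family `W` of subsets. -/
noncomputable def tW {X : Type*} (t : Set X → ℝ) (W : Set (Set X)) : ℝ :=
  ∑ᶠ U ∈ W, t U

/-- A midpoints structure on a linearly ordered set `X`, given as a symmetric map
assigning to each (unordered) pair `{x,y}` a subset `m x y ⊆ X` such that
`{x,y} ∩ m x y = {max x y}` for `x ≠ y`. -/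
def IsMidpoints {X : Type*} [LinearOrder X] (m : X → X → Set X) : Prop :=
  (∀ x y : X, m x y = m y x) ∧
  (∀ x y : X, x ≠ y → ({x, y} : Set X) ∩ m x y = {max x y})

/-- `t ∈ ℝ^{2^X}` is a tree realization of the midpoints structure `m`:
(1) `t(S) = t(Sᶜ) ≥ 0`; (2) if all four intersections `S^e ∩ T^f` are nonempty
then `t(S)·t(T) = 0`; (3) for `x ≠ x'`, `t_{[{x},m{x,x'}]} > t_{[{x'},m{x,x'})}`. -/
def IsTreeRealization {X : Type*} (m : X → X → Set X) (t : Set X → ℝ) : Prop :=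
  (∀ S : Set X, t S = t Sᶜ ∧ 0 ≤ t S) ∧
  (∀ S T : Set X, (∀ e f : Bool, (sel S e ∩ sel T f).Nonempty) → t S * t T = 0) ∧
  (∀ x x' : X, x ≠ x' → tW t (ico {x'} (m x x')) < tW t (icc {x} (m x x')))

/-! ## The variable structure `m₀` and its explicit realization -/

/-- The set `X₀ = {x_{v,s} | v ∈ [0,V+1], s ∈ {−1,1}}`, with `x_{v,s}` encoded as the
pair `(v, s)` where `s : Bool` (`false` for `−1`, `true` for `+1`); the linear
(lexicographic) order `x_{v',s'} < x_{v,s}` iff `v' < v`, or `v' = v` and `s' < s`,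
is given by comparing `key`. -/
abbrev X₀ (V : ℕ) := Fin (V + 2) × Bool

/-- The rank of `x_{v,s}` in the lexicographic order on `X₀`. -/
def key {V : ℕ} (x : X₀ V) : ℕ := 2 * (x.1 : ℕ) + (if x.2 then 1 else 0)

/-- The sign `s ∈ {−1,+1}` encoded by a Boolean. -/
def sgn (b : Bool) : ℤ := if b then 1 else -1

/-- The midpoints structure `m₀` on `X₀`: for `x_{v',s'} < x_{v,s}`,
`m₀{x_{v',s'},x_{v,s}} = {x_{u,r} | u ≥ v}` if `2v'+s' = 2v+s` and `v' < v`, and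
`= {x_{v,s}}` if `2v'+s' < 2v+s`. -/
def m₀ {V : ℕ} (a b : X₀ V) : Set (X₀ V) :=
  let big := if key a ≤ key b then b else a
  let small := if key a ≤ key b then a else b
  if 2 * (small.1 : ℤ) + sgn small.2 = 2 * (big.1 : ℤ) + sgn big.2 ∧ small.1 < big.1
  then {x : X₀ V | big.1 ≤ x.1}
  else {big}

/-- The explicit tree vector `t₀`: `t({x_{u,r} | u ≥ v}) = t({x_{u,r} | u < v}) = 1`
for `v ∈ [1,V+1]`, `t({x_{v,s}}) = t({x_{v,s}}ᶜ) = 10^{v+(s+1)/2}` for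
`(v,s) ≠ (0,−1)`, `t({x_{0,−1}}) = t({x_{0,−1}}ᶜ) = 0`, and `t(S) = 0` for all
other `S ⊆ X₀`. -/
noncomputable def t₀ (V : ℕ) (S : Set (X₀ V)) : ℝ :=
  (∑ v : Fin (V + 2),
    if 1 ≤ (v : ℕ) ∧ (S = {x : X₀ V | v ≤ x.1} ∨ S = {x : X₀ V | v ≤ x.1}ᶜ)
    then 1 else 0) +
  (∑ x : X₀ V,
    if x ≠ ((0 : Fin (V + 2)), false) ∧ (S = {x} ∨ S = ({x} : Set (X₀ V))ᶜ)
    then (10 : ℝ) ^ ((x.1 : ℕ) + (if x.2 then 1 else 0)) else 0)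

theorem aux_ne_compl {X : Type*} [Nonempty X] (A : Set X) : A ≠ Aᶜ := by
  intro h
  obtain ⟨x⟩ := (inferInstance : Nonempty X)
  have := Set.ext_iff.1 h x
  simp at this

noncomputable def ind {X : Type*} (W : Set (Set X)) (A : Set X) : ℝ :=
  (if A ∈ W then 1 else 0) + (if Aᶜ ∈ W then 1 else 0)

theorem aux_sum {X : Type*} [Fintype X] [Nonempty X] (W : Set (Set X)) (A : Set X) (P : Prop)
    (c : ℝ) :
    (∑ U : Set X, if U ∈ W then (if P ∧ (U = A ∨ U = Aᶜ) then c else 0) else 0)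
      = if P then c * ind W A else 0 := by
  have h : ∀ U : Set X, (if U ∈ W then (if P ∧ (U = A ∨ U = Aᶜ) then c else 0) else 0) =
      (if U = A then (if A ∈ W ∧ P then c else 0) else 0) +
      (if U = Aᶜ then (if Aᶜ ∈ W ∧ P then c else 0) else 0) := by
    intro U
    have hA := aux_ne_compl A
    by_cases h1 : U = A
    · subst h1
      by_cases hP : P <;> by_cases hW : U ∈ W <;> simp [hP, hW, hA]
    · by_cases h2 : U = Aᶜ
      · subst h2
        by_cases hP : P <;> by_cases hW : Aᶜ ∈ W <;> simp [hP, hW, hA.symm]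
      · simp [h1, h2]
  rw [Finset.sum_congr rfl (fun U _ => h U), Finset.sum_add_distrib]
  simp only [Finset.sum_ite_eq', Finset.mem_univ, if_true, ind]
  by_cases hP : P <;> by_cases hW : A ∈ W <;> by_cases hW' : Aᶜ ∈ W <;> simp [hP, hW, hW'] <;> ring

def Lv {V : ℕ} (v : Fin (V + 2)) : Set (X₀ V) := {x : X₀ V | v ≤ x.1}

theorem not_le_zero' {V : ℕ} {v : Fin (V+2)} (hv : 1 ≤ (v:ℕ)) : ¬ v ≤ 0 := by
  intro h
  have h2 : (v:ℕ) ≤ 0 := h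
  omega

def ex {V : ℕ} (x : X₀ V) : ℕ := (x.1 : ℕ) + (if x.2 then 1 else 0)

theorem aux_tW (V : ℕ) (W : Set (Set (X₀ V))) : tW (t₀ V) W =
    (∑ v : Fin (V + 2), if 1 ≤ (v : ℕ) then ind W (Lv v) else 0) +
    (∑ x : X₀ V, if x ≠ ((0 : Fin (V + 2)), false) then (10 : ℝ) ^ ex x * ind W {x} else 0) := by
  have h0 : tW (t₀ V) W = ∑ U : Set (X₀ V), if U ∈ W then t₀ V U else 0 := by
    unfold tW
    rw [← finsum_eq_sum_of_fintype]
    apply finsum_congr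
    intro U
    by_cases h : U ∈ W <;> simp [h]
  rw [h0]
  have h1 : ∀ U : Set (X₀ V), (if U ∈ W then t₀ V U else 0) =
      (∑ v : Fin (V + 2), if U ∈ W then
        (if 1 ≤ (v : ℕ) ∧ (U = Lv v ∨ U = (Lv v)ᶜ) then (1:ℝ) else 0) else 0) +
      (∑ x : X₀ V, if U ∈ W then (if x ≠ ((0 : Fin (V + 2)), false) ∧ (U = {x} ∨ U = ({x} : Set (X₀ V))ᶜ)
    then (10 : ℝ) ^ ex x else 0) else 0) := by
    intro U
    by_cases h : U ∈ W
    · simp only [h, if_true]; rfl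
    · simp [h]
  rw [Finset.sum_congr rfl (fun U _ => h1 U), Finset.sum_add_distrib, Finset.sum_comm]
  congr 1
  · apply Finset.sum_congr rfl
    intro v _
    have := aux_sum W (Lv v) (1 ≤ (v : ℕ)) 1
    rw [one_mul] at this
    convert this
  · rw [Finset.sum_comm]
    apply Finset.sum_congr rfl
    intro x _
    convert aux_sum W {x} (x ≠ ((0 : Fin (V + 2)), false)) ((10:ℝ) ^ ex x)

theorem ind_nonneg {X : Type*} (W : Set (Set X)) (A : Set X) : 0 ≤ ind W A := by
  unfold ind; split_ifs <;> norm_num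

theorem ind_le_two {X : Type*} (W : Set (Set X)) (A : Set X) : ind W A ≤ 2 := by
  unfold ind; split_ifs <;> norm_num

theorem ind_zero {X : Type*} {W : Set (Set X)} {A : Set X} (h : A ∉ W) (h' : Aᶜ ∉ W) :
    ind W A = 0 := by simp [ind, h, h']

theorem ind_two {X : Type*} {W : Set (Set X)} {A : Set X} (h : A ∈ W) (h' : Aᶜ ∈ W) :
    ind W A = 2 := by simp [ind, h, h']; norm_num

theorem ind_le_one {X : Type*} {W : Set (Set X)} {A : Set X} (h : A ∉ W ∨ Aᶜ ∉ W) :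
    ind W A ≤ 1 := by
  unfold ind
  rcases h with h | h <;> simp [h] <;> split_ifs <;> norm_num

theorem t₀_nonneg (V : ℕ) (S : Set (X₀ V)) : 0 ≤ t₀ V S := by
  unfold t₀
  apply add_nonneg <;> apply Finset.sum_nonneg <;> intro i _ <;> split_ifs <;> positivity

theorem t₀_compl (V : ℕ) (S : Set (X₀ V)) : t₀ V S = t₀ V Sᶜ := by
  have h : ∀ A : Set (X₀ V), (S = A ∨ S = Aᶜ) ↔ (Sᶜ = A ∨ Sᶜ = Aᶜ) := by
    intro A
    rw [compl_inj_iff, compl_eq_comm, eq_comm (a := Aᶜ)]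
    exact or_comm
  unfold t₀
  congr 1 <;> apply Finset.sum_congr rfl <;> intro i _
  · exact if_congr (and_congr_right fun _ => h _) rfl rfl
  · exact if_congr (and_congr_right fun _ => h _) rfl rfl

theorem t₀_supp {V : ℕ} {S : Set (X₀ V)} (h : t₀ V S ≠ 0) :
    (∃ v : Fin (V+2), S = Lv v ∨ S = (Lv v)ᶜ) ∨ (∃ x, S = {x} ∨ S = ({x} : Set (X₀ V))ᶜ) := by
  by_contra! hc
  apply h
  unfold t₀
  rw [Finset.sum_eq_zero, Finset.sum_eq_zero, add_zero]
  · intro x _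
    rw [if_neg]
    rintro ⟨_, h | h⟩
    · exact (hc.2 x).1 h
    · exact (hc.2 x).2 h
  · intro x _
    rw [if_neg]
    rintro ⟨_, h | h⟩
    · exact (hc.1 x).1 h
    · exact (hc.1 x).2 h

/-- crossing -/
def Cr {X : Type*} (S T : Set X) : Prop :=
  (S ∩ T).Nonempty ∧ (Sᶜ ∩ T).Nonempty ∧ (S ∩ Tᶜ).Nonempty ∧ (Sᶜ ∩ Tᶜ).Nonempty

theorem Cr.cl {X : Type*} {S T : Set X} (h : Cr S T) : Cr Sᶜ T := by
  obtain ⟨a, b, c, d⟩ := h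
  exact ⟨b, by simpa using a, d, by simpa using c⟩

theorem Cr.symm {X : Type*} {S T : Set X} (h : Cr S T) : Cr T S := by
  obtain ⟨a, b, c, d⟩ := h

  exact ⟨by rwa [Set.inter_comm], by rwa [Set.inter_comm], by rwa [Set.inter_comm],
    by rwa [Set.inter_comm]⟩

theorem Cr.single {X : Type*} {x : X} {T : Set X} (h : Cr {x} T) : False := by
  obtain ⟨⟨a, ha, ha'⟩, -, ⟨c, hc, hc'⟩, -⟩ := h
  simp only [Set.mem_singleton_iff] at ha hc
  subst ha; subst hc; exact hc' ha'

theorem Cr.lv {V : ℕ} {v w : Fin (V+2)} (h : Cr (Lv v) (Lv w)) : False := by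
  obtain ⟨-, ⟨a, ha, ha'⟩, ⟨b, hb, hb'⟩, -⟩ := h
  simp only [Lv, Set.mem_compl_iff, Set.mem_ofPred_eq] at *
  omega

theorem mem_icc {X : Type*} {x : X} {T U : Set X} (hx : x ∈ T) (hT : ∃ y, y ≠ x ∧ y ∉ T) :
    U ∈ icc {x} T ↔ (x ∈ U ∧ U ⊆ T) ∨ (x ∉ U ∧ Uᶜ ⊆ T) := by
  have key : ∀ A : Set X, (∃ e f : Bool, sel {x} e ⊆ A ∧ A ⊆ sel T f) →
      (x ∈ A ∧ A ⊆ T) ∨ (x ∉ A ∧ Aᶜ ⊆ T) := by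
    rintro A ⟨e, f, h1, h2⟩
    cases e <;> cases f <;> simp only [sel, if_true, Bool.false_eq_true, if_false] at h1 h2
    · right
      refine ⟨fun h => h2 h hx, fun y hy => ?_⟩
      by_cases hyx : y = x
      · exact hyx ▸ hx
      · exact absurd (h1 hyx) hy
    · obtain ⟨y, hy, hy'⟩ := hT
      exact absurd (h2 (h1 hy)) hy'
    · exact absurd hx (h2 (h1 rfl))
    · exact Or.inl ⟨h1 rfl, h2⟩
  constructor
  · rintro ⟨e, f, g, h1, h2⟩
    have := key _ ⟨e, f, h1, h2⟩
    cases g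
    · simp only [sel, Bool.false_eq_true, if_false, Set.mem_compl_iff, not_not, compl_compl] at this
      exact this.symm
    · exact this
  · rintro (⟨h1, h2⟩ | ⟨h1, h2⟩)
    · exact ⟨true, true, true, by simpa [sel] using h1, by simpa [sel] using h2⟩
    · exact ⟨true, true, false, by simpa [sel] using h1, by simpa [sel] using h2⟩

theorem icc_compl {X : Type*} (S T : Set X) : icc S Tᶜ = icc S T := by
  ext U
  constructor
  · rintro ⟨e, f, g, h1, h2⟩
    exact ⟨e, !f, g, h1, by cases f <;> simpa [sel] using h2⟩
  · rintro ⟨e, f, g, h1, h2⟩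
    exact ⟨e, !f, g, h1, by cases f <;> simpa [sel] using h2⟩

theorem ex_third {V : ℕ} (a b : X₀ V) : ∃ y : X₀ V, y ≠ a ∧ y ≠ b := by
  by_contra! h
  have h1 := h (0, false)
  have h2 := h (0, true)
  have h3 := h (1, false)
  have h4 : (0 : Fin (V+2)) ≠ 1 := by
    intro h
    exact not_le_zero' (v := (1 : Fin (V+2))) (by simp) h.symm.le
  grind

theorem mem_icc_single_self {V : ℕ} {b : X₀ V} {U : Set (X₀ V)} :
    U ∈ icc {b} {b} ↔ U = {b} ∨ U = {b}ᶜ := by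
  obtain ⟨y, hy, -⟩ := ex_third b b
  rw [mem_icc (T := {b}) rfl ⟨y, hy, hy⟩]
  constructor
  · rintro (⟨h1, h2⟩ | ⟨h1, h2⟩)
    · exact Or.inl (Set.Subset.antisymm h2 (by simpa using h1))
    · right
      rw [← compl_inj_iff, compl_compl]
      exact Set.Subset.antisymm h2 (by simpa using h1)
  · rintro (rfl | rfl) <;> simp

theorem mem_icc_single {V : ℕ} {a b : X₀ V} (hab : a ≠ b) {U : Set (X₀ V)} :
    U ∈ icc {a} {b} ↔ (a ∈ U ∧ b ∉ U) ∨ (a ∉ U ∧ b ∈ U) := by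
  rw [← icc_compl, mem_icc (by simpa using hab) ⟨b, hab.symm, by simp⟩]
  simp

theorem Lv_ne {V : ℕ} (v : Fin (V+2)) (b : X₀ V) : Lv v ≠ {b} ∧ ((v:ℕ) ≥ 1 → Lv v ≠ {b}ᶜ) := by
  constructor
  · intro h
    have h1 : ((v, false) : X₀ V) ∈ Lv v := le_refl v
    have h2 : ((v, true) : X₀ V) ∈ Lv v := le_refl v
    rw [h] at h1 h2
    simp at h1 h2
    grind
  · intro hv h
    have h1 : ((0, false) : X₀ V) ∉ Lv v := not_le_zero' hv
    have h2 : ((0, true) : X₀ V) ∉ Lv v := not_le_zero' hv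
    rw [h] at h1 h2
    simp at h1 h2
    grind

theorem tW_le {V : ℕ} {W : Set (Set (X₀ V))} (f : Fin (V+2) → ℝ) (g : X₀ V → ℝ)
    (hf : ∀ v : Fin (V+2), 1 ≤ (v:ℕ) → ind W (Lv v) ≤ f v) (hf0 : ∀ v, 0 ≤ f v)
    (hg : ∀ x : X₀ V, ind W {x} ≤ g x) (hg0 : ∀ v, 0 ≤ g v) :
    tW (t₀ V) W ≤ ∑ v, f v + ∑ x : X₀ V, g x * 10 ^ ex x := by
  rw [aux_tW]
  apply add_le_add <;> apply Finset.sum_le_sum <;> intro i _ <;> split_ifs with h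
  · exact hf i h
  · exact hf0 i
  · rw [mul_comm]
    exact mul_le_mul_of_nonneg_right (hg i) (by positivity)
  · have := hg0 i
    positivity

theorem le_tW {V : ℕ} {W : Set (Set (X₀ V))} (f : Fin (V+2) → ℝ) (b : X₀ V)
    (hf : ∀ v : Fin (V+2), 1 ≤ (v:ℕ) → f v ≤ ind W (Lv v)) (hf0 : ∀ v : Fin (V+2), (v:ℕ) = 0 → f v ≤ 0)
    (hb : b ≠ (0, false)) (hg : {b} ∈ W) (hg' : {b}ᶜ ∈ W) :
    ∑ v, f v + 2 * 10 ^ ex b ≤ tW (t₀ V) W := by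
  rw [aux_tW]
  apply add_le_add
  · apply Finset.sum_le_sum
    intro i _
    split_ifs with h
    · exact hf i h
    · exact hf0 i (by omega)
  · have := Finset.single_le_sum (f := fun x : X₀ V =>
      if x ≠ ((0 : Fin (V + 2)), false) then (10 : ℝ) ^ ex x * ind W {x} else 0)
      (s := Finset.univ) (fun i _ => by
        have := ind_nonneg W {i}
        split_ifs <;> positivity) (Finset.mem_univ b)
    simp only [hb, ne_eq, not_false_eq_true, if_true, ind_two hg hg'] at this
    rw [mul_comm]; exact this

theorem single_ne_compl {V : ℕ} (a b : X₀ V) : ({a} : Set (X₀ V)) ≠ {b}ᶜ := by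
  intro h
  obtain ⟨y, h1, h2⟩ := ex_third a b
  have := Set.ext_iff.1 h y
  simp [h1, h2] at this

theorem caseA1 {V : ℕ} {a b : X₀ V} (hab : a ≠ b) (hb : b ≠ (0, false)) (hv : a.1 ≤ b.1)
    (he : ex a < ex b) :
    tW (t₀ V) (ico {a} {b}) < tW (t₀ V) (icc {b} {b}) := by
  have h1 := tW_le (W := ico {a} {b}) (fun v => if v ∈ Finset.Ioc a.1 b.1 then 2 else 0)
    (fun x => (if x = a then 2 else 0) + (if x = b then 1 else 0)) (by
      intro v hv1
      split_ifs with h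
      · exact ind_le_two _ _
      · apply le_of_eq
        have : ¬ ((a ∈ Lv v ∧ b ∉ Lv v) ∨ (a ∉ Lv v ∧ b ∈ Lv v)) := by
          simp only [Lv, Set.mem_ofPred_eq, Finset.mem_Ioc] at *
          omega
        apply ind_zero
        · rintro ⟨h, -⟩
          exact this ((mem_icc_single hab).1 h)
        · rintro ⟨h, -⟩
          rw [mem_icc_single hab] at h
          simp only [Set.mem_compl_iff] at h
          tauto)
    (by intro v; split_ifs <;> norm_num)
    (by
      intro x
      by_cases hxa : x = a
      · have := ind_le_two (ico {a} {b}) {x}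
        simp only [hxa, hab, if_true, if_false]
        rw [hxa] at this
        linarith
      · by_cases hxb : x = b
        · simp only [hxb, hab.symm, if_true, if_false, zero_add]
          apply ind_le_one
          left
          rintro ⟨-, h⟩
          exact h rfl
        · simp only [hxa, hxb, if_false, add_zero]
          apply le_of_eq
          apply ind_zero
          · rintro ⟨h, -⟩
            rw [mem_icc_single hab] at h
            simp only [Set.mem_singleton_iff] at h
            grind
          · rintro ⟨h, -⟩
            rw [mem_icc_single hab] at h
            simp only [Set.mem_compl_iff, Set.mem_singleton_iff] at h
            grind)
    (by intro v; split_ifs <;> norm_num)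
  have h2 := le_tW (W := icc {b} {b}) (fun _ => 0) b (fun v _ => ind_nonneg _ _) (by simp) hb
    (mem_icc_single_self.2 (Or.inl rfl)) (mem_icc_single_self.2 (Or.inr rfl))
  refine lt_of_le_of_lt h1 (lt_of_lt_of_le ?_ h2)
  simp only [add_mul, Finset.sum_add_distrib, ite_mul, zero_mul, Finset.sum_ite_eq',
    Finset.mem_univ, if_true, Finset.sum_const_zero, Finset.sum_ite_mem, Finset.univ_inter,
    Finset.sum_const, Fin.card_Ioc, nsmul_eq_mul]
  obtain ⟨d, hd⟩ : ∃ d, ex b = ex a + 1 + d := ⟨ex b - ex a - 1, by omega⟩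
  have hd2 : (b.1 : ℕ) - a.1 ≤ d + 2 := by
    unfold ex at hd
    split_ifs at hd <;> omega
  have hd3 : (((b.1 : ℕ) - a.1 : ℕ) : ℝ) ≤ d + 2 := by exact_mod_cast hd2
  have hp : (1:ℝ) + d * 9 ≤ 10 ^ d := by
    have := one_add_mul_le_pow (a := (9:ℝ)) (by norm_num) d
    norm_num at this
    linarith
  have hq : (1:ℝ) ≤ 10 ^ ex a := one_le_pow₀ (by norm_num)
  have hdn : (0:ℝ) ≤ d := by positivity
  rw [hd, pow_add, pow_add]
  nlinarith [mul_nonneg (sub_nonneg.2 hq) (sub_nonneg.2 hp), mul_nonneg (sub_nonneg.2 hq) hdn]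

theorem caseA2 {V : ℕ} {a b : X₀ V} (hab : a ≠ b) (hb : b ≠ (0, false)) :
    tW (t₀ V) (ico {b} {b}) < tW (t₀ V) (icc {a} {b}) := by
  have h1 := tW_le (W := ico {b} {b}) (fun v => 0)
    (fun x => (if x = b then 1 else 0)) (by
      intro v hv1
      have := Lv_ne v b
      apply le_of_eq
      apply ind_zero
      · rintro ⟨h, -⟩
        rw [mem_icc_single_self] at h
        tauto
      · rintro ⟨h, -⟩
        rw [mem_icc_single_self, compl_inj_iff, compl_eq_comm, eq_comm (b := Lv v)] at h
        tauto)
    (by intro v; norm_num)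
    (by
      intro x
      by_cases hxb : x = b
      · simp only [hxb, if_true]
        apply ind_le_one
        left
        rintro ⟨-, h⟩
        exact h rfl
      · simp only [hxb, if_false]
        apply le_of_eq
        have := single_ne_compl x b
        apply ind_zero
        · rintro ⟨h, -⟩
          rw [mem_icc_single_self] at h
          simp [hxb, this] at h
        · rintro ⟨h, -⟩
          rw [mem_icc_single_self, compl_inj_iff, compl_eq_comm] at h
          simp [hxb, this.symm] at h)
    (by intro v; split_ifs <;> norm_num)
  have h2 := le_tW (W := icc {a} {b}) (fun _ => 0) b (fun v _ => ind_nonneg _ _) (by simp) hb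
    ((mem_icc_single hab).2 (by simp [hab])) ((mem_icc_single hab).2 (by simp [hab]))
  refine lt_of_le_of_lt h1 (lt_of_lt_of_le ?_ h2)
  simp only [ite_mul, zero_mul, Finset.sum_ite_eq', Finset.mem_univ, if_true,
    Finset.sum_const_zero]
  have : (0:ℝ) < 10 ^ ex b := by positivity
  linarith

theorem mem_icc_Lv_ge {V : ℕ} {w : Fin (V+2)} (hw : 1 ≤ (w:ℕ)) {x : X₀ V} (hx : w ≤ x.1)
    {U : Set (X₀ V)} : U ∈ icc {x} (Lv w) ↔ (x ∈ U ∧ U ⊆ Lv w) ∨ (x ∉ U ∧ Uᶜ ⊆ Lv w) := by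
  have h0 : ¬ w ≤ 0 := not_le_zero' hw
  refine mem_icc hx ⟨(0, false), ?_, h0⟩
  rintro rfl
  exact h0 hx

theorem mem_icc_Lv_lt {V : ℕ} {w : Fin (V+2)} {x : X₀ V} (hx : x.1 < w)
    {U : Set (X₀ V)} : U ∈ icc {x} (Lv w) ↔ (x ∈ U ∧ U ⊆ (Lv w)ᶜ) ∨ (x ∉ U ∧ Uᶜ ⊆ (Lv w)ᶜ) := by
  rw [← icc_compl]
  refine mem_icc (not_le.2 hx) ⟨(w, false), ?_, fun h => h (le_refl w)⟩
  rintro rfl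
  exact lt_irrefl _ hx

/-- common statement: `icc {x} (Lv w)` hits only `{x}` and `Lv w`. -/
theorem icc_Lv {V : ℕ} {w : Fin (V+2)} (hw : 1 ≤ (w:ℕ)) {x : X₀ V}
    (hx : x.1 = w ∨ (x.1 : ℕ) + 1 = w) :
    (∀ v : Fin (V+2), 1 ≤ (v:ℕ) → v ≠ w → Lv v ∉ icc {x} (Lv w) ∧ (Lv v)ᶜ ∉ icc {x} (Lv w)) ∧
    (∀ y, y ≠ x → {y} ∉ icc {x} (Lv w) ∧ {y}ᶜ ∉ icc {x} (Lv w)) ∧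
    (Lv w ∈ icc {x} (Lv w) ∧ (Lv w)ᶜ ∈ icc {x} (Lv w)) ∧
    ({x} ∈ icc {x} (Lv w) ∧ {x}ᶜ ∈ icc {x} (Lv w)) := by
  have h0w : ((0, false) : X₀ V) ∉ Lv w := not_le_zero' hw
  have h0w' : ((0, true) : X₀ V) ∉ Lv w := not_le_zero' hw
  have hwf : ((w, false) : X₀ V) ∈ Lv w := le_refl w
  have hwt : ((w, true) : X₀ V) ∈ Lv w := le_refl w
  have third : ∀ y : X₀ V, ¬ ({y}ᶜ ⊆ Lv w) ∧ ¬ ({y}ᶜ ⊆ (Lv w)ᶜ) := by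
    intro y
    constructor
    · intro h
      by_cases hy : y = (0, false)
      · exact h0w' (h (by simp [hy]))
      · exact h0w (h (fun h => hy h.symm))
    · intro h
      by_cases hy : y = (w, false)
      · exact (h (show (w, true) ∈ _ by simp [hy])) hwt
      · exact (h (fun h => hy h.symm)) hwf
  rcases hx with hx | hx
  · have hxw : x ∈ Lv w := hx.ge
    simp only [mem_icc_Lv_ge hw hx.ge]
    refine ⟨fun v hv hvw => ?_, fun y hy => ?_, ?_, ?_⟩
    · have A : x ∈ Lv v → ¬ Lv v ⊆ Lv w := by
        intro h1 h2
        have h3 : w ≤ v := h2 (show ((v, false) : X₀ V) ∈ Lv v from le_refl v)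
        have h4 : v ≤ x.1 := h1
        rw [hx] at h4
        exact hvw (le_antisymm h4 h3)
      have B : ¬ (Lv v)ᶜ ⊆ Lv w := fun h => h0w (h (not_le_zero' hv))
      simp only [Set.mem_compl_iff, not_not, compl_compl]
      tauto
    · have := third y
      simp only [Set.mem_compl_iff, not_not, compl_compl, Set.mem_singleton_iff]
      have := hy.symm
      tauto
    · simp [hxw]
    · simp [hxw]
  · have hlt : x.1 < w := by rw [Fin.lt_def]; omega
    have hxw : x ∉ Lv w := not_le.2 hlt
    simp only [mem_icc_Lv_lt hlt]
    refine ⟨fun v hv hvw => ?_, fun y hy => ?_, ?_, ?_⟩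
    · have A : x ∉ Lv v → ¬ (Lv v)ᶜ ⊆ (Lv w)ᶜ := by
        intro h1 h2
        rw [Set.compl_subset_compl] at h2
        have h3 : v ≤ w := h2 hwf
        have h4 : ¬ v ≤ x.1 := h1
        rw [Fin.le_def] at h3 h4
        apply hvw
        ext
        omega
      have B : ¬ (Lv v) ⊆ (Lv w)ᶜ := fun h =>
        h (show (Fin.last (V+1), false) ∈ _ from Fin.le_last v) (Fin.le_last w)
      simp only [Set.mem_compl_iff, not_not, compl_compl]
      tauto
    · have := third y
      simp only [Set.mem_compl_iff, not_not, compl_compl, Set.mem_singleton_iff]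
      have := hy.symm
      tauto
    · simp [hxw]
    · simp [hxw]

theorem caseB {V : ℕ} {w : Fin (V+2)} (hw : 1 ≤ (w:ℕ)) {x x' : X₀ V}
    (hx : x.1 = w ∨ (x.1 : ℕ) + 1 = w) (hx' : x'.1 = w ∨ (x'.1 : ℕ) + 1 = w)
    (hx0 : x ≠ (0, false)) (he : ex x = ex x') :
    tW (t₀ V) (ico {x'} (Lv w)) < tW (t₀ V) (icc {x} (Lv w)) := by
  obtain ⟨a1, a2, a3, a4⟩ := icc_Lv hw hx
  obtain ⟨b1, b2, b3, b4⟩ := icc_Lv hw hx'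
  have h1 := tW_le (W := ico {x'} (Lv w)) (fun v => if v = w then 1 else 0)
    (fun x => (if x = x' then 2 else 0)) (by
      intro v hv
      split_ifs with h
      · apply ind_le_one
        left
        rintro ⟨-, h'⟩
        exact h' (by rw [h]; rfl)
      · exact (ind_zero (fun h' => (b1 v hv h).1 h'.1) (fun h' => (b1 v hv h).2 h'.1)).le)
    (by intro v; split_ifs <;> norm_num)
    (by
      intro y
      split_ifs with h
      · exact ind_le_two _ _
      · exact (ind_zero (fun h' => (b2 y h).1 h'.1) (fun h' => (b2 y h).2 h'.1)).le)
    (by intro v; split_ifs <;> norm_num)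
  have h2 := le_tW (W := icc {x} (Lv w)) (fun v => if v = w then 2 else 0) x (by
      intro v hv
      split_ifs with h
      · rw [h, ind_two a3.1 a3.2]
      · exact ind_nonneg _ _)
    (by
      intro v hv
      rw [if_neg]
      rintro rfl
      omega) hx0 a4.1 a4.2
  refine lt_of_le_of_lt h1 (lt_of_lt_of_le ?_ h2)
  simp only [ite_mul, zero_mul, Finset.sum_ite_eq', Finset.mem_univ, if_true, he]
  linarith

theorem key_inj {V : ℕ} {a b : X₀ V} (h : key a = key b) : a = b := by
  obtain ⟨v, s⟩ := a
  obtain ⟨w, r⟩ := b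
  cases s <;> cases r <;> simp [key] at h ⊢ <;> omega

/-- The two inequalities for an ordered pair. -/
theorem ordered {V : ℕ} {a b : X₀ V} (h : key a < key b) (M : Set (X₀ V))
    (hM : M = if 2 * (a.1 : ℤ) + sgn a.2 = 2 * (b.1 : ℤ) + sgn b.2 ∧ a.1 < b.1
      then {x : X₀ V | b.1 ≤ x.1} else {b}) :
    tW (t₀ V) (ico {a} M) < tW (t₀ V) (icc {b} M) ∧
    tW (t₀ V) (ico {b} M) < tW (t₀ V) (icc {a} M) := by
  have hb : b ≠ (0, false) := by
    rintro rfl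
    simp [key] at h
  have hab : a ≠ b := by
    rintro rfl
    exact lt_irrefl _ h
  subst hM
  obtain ⟨v, s⟩ := a
  obtain ⟨w, r⟩ := b
  split_ifs with hc
  · obtain ⟨hc1, hc2⟩ := hc
    rw [Fin.lt_def] at hc2
    dsimp only at hc1 hc2
    have hs : s = true ∧ r = false ∧ (v:ℕ) + 1 = w := by
      cases s <;> cases r <;> simp [sgn] at hc1 ⊢ <;> omega
    obtain ⟨rfl, rfl, hvw⟩ := hs
    have hw : 1 ≤ (w:ℕ) := by omega
    constructor
    · exact caseB hw (Or.inl rfl) (Or.inr hvw) hb (by simp [ex]; omega)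
    · exact caseB hw (Or.inr hvw) (Or.inl rfl) (by simp) (by simp [ex]; omega)
  · rw [Fin.lt_def] at hc
    dsimp only at hc
    have hvw : (v:ℕ) ≤ w := by
      unfold key at h
      dsimp only at h
      split_ifs at h <;> omega
    refine ⟨caseA1 hab hb hvw ?_, caseA2 hab hb⟩
    cases s <;> cases r <;> simp [key, sgn, ex] at h hc ⊢ <;> omega

/-- The vector `t₀` is a tree realization of the midpoints structure `m₀`. -/
theorem t₀_isTreeRealization_m₀ (V : ℕ) :
    IsTreeRealization (m₀ (V := V)) (t₀ V) := by
  refine ⟨fun S => ⟨t₀_compl V S, t₀_nonneg V S⟩, ?_, ?_⟩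
  · intro S T h
    have hC : Cr S T := ⟨by simpa [sel] using h true true, by simpa [sel] using h false true,
      by simpa [sel] using h true false, by simpa [sel] using h false false⟩
    by_contra hne
    rw [mul_eq_zero, not_or] at hne
    have hcl : ∀ {A B : Set (X₀ V)}, Cr Aᶜ B → Cr A B := fun h => by simpa using h.cl
    rcases t₀_supp hne.1 with ⟨v, hv⟩ | ⟨x, rfl | rfl⟩
    · rcases t₀_supp hne.2 with ⟨w, hw⟩ | ⟨x, rfl | rfl⟩
      · have h1 : Cr (Lv v) T := by
          rcases hv with rfl | rfl
          · exact hC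
          · exact hcl hC
        have h2 : Cr (Lv w) (Lv v) := by
          rcases hw with rfl | rfl
          · exact h1.symm
          · exact hcl h1.symm
        exact h2.lv
      · exact hC.symm.single
      · exact (hcl hC.symm).single
    · exact hC.single
    · exact (hcl hC).single
  · intro x x' hne
    rcases lt_or_gt_of_ne (fun h => hne (key_inj h)) with h | h
    · refine (ordered h _ ?_).2
      simp only [m₀, h.le, if_true]
    · refine (ordered h _ ?_).1
      simp only [m₀, not_le.2 h, if_false]
end

section
/- Let t be a tree realization of some midpoints structure on X, let U_0, U_1, U_2, U_3 be pairwise disjoint nonempty subsets of X with union X and t(U_i) > 0 for every i, and let j ≠ k in {0,1,2,3}. If T ⊆ X satisfies t(T) > 0 and T ∈ (U_j, U_k) (i.e., T ∈ [U_j,U_k] and T ∉ {U_j, U_j^c, U_k, U_k^c}), then there exists i ∈ {0,1,2,3} ∖ {j,k} such that T = U_i ∪ U_j or T^c = U_i ∪ U_j. -/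
open Classical

/-- Let `t` be a tree realization of some midpoints structure on `X` and let
`U₀, U₁, U₂, U₃` be pairwise disjoint nonempty subsets partitioning `X` with
`t(Uᵢ) > 0` for all `i`, and let `j ≠ k`. If `T ⊆ X` satisfies `t(T) > 0` and
`T ∈ (Uⱼ, Uₖ)`, then `T = Uᵢ ∪ Uⱼ` or `Tᶜ = Uᵢ ∪ Uⱼ` for some `i ∉ {j,k}`. -/
theorem mem_ioo_eq_union {X : Type*} [Fintype X] [LinearOrder X]
    (m : X → X → Set X) (hm : IsMidpoints m)
    (t : Set X → ℝ) (ht : IsTreeRealization m t)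
    (U : Fin 4 → Set X)
    (hdisj : ∀ i j, i ≠ j → Disjoint (U i) (U j))
    (hne : ∀ i, (U i).Nonempty)
    (hcover : (⋃ i, U i) = Set.univ)
    (hpos : ∀ i, 0 < t (U i))
    (j k : Fin 4) (hjk : j ≠ k)
    (T : Set X) (hT : 0 < t T) (hTmem : T ∈ ioo (U j) (U k)) :
    ∃ i : Fin 4, i ≠ j ∧ i ≠ k ∧ (T = U i ∪ U j ∨ Tᶜ = U i ∪ U j) := by
  obtain ⟨h1, h2, -⟩ := ht
  have key : ∀ V : Set X, 0 < t V → U j ⊆ V → V ⊆ (U k)ᶜ → V ≠ U j → V ≠ (U k)ᶜ →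
      ∃ i : Fin 4, i ≠ j ∧ i ≠ k ∧ V = U i ∪ U j := by
    intro V hV hj hk nj nk
    have split : ∀ i, i ≠ j → i ≠ k → U i ⊆ V ∨ Disjoint (U i) V := by
      intro i hij hik
      by_contra hcon
      push Not at hcon
      obtain ⟨hc1, hc2⟩ := hcon
      obtain ⟨x, hx, hxV⟩ := Set.not_subset.1 hc1
      obtain ⟨y, hy, hyV⟩ := Set.not_disjoint_iff.1 hc2
      obtain ⟨u, hu⟩ := hne j
      obtain ⟨v, hv⟩ := hne k
      have hui : u ∉ U i := fun h => Set.disjoint_left.1 (hdisj i j hij) h hu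
      have hvi : v ∉ U i := fun h => Set.disjoint_left.1 (hdisj i k hik) h hv
      have hvV : v ∉ V := fun h => hk h hv
      have := h2 (U i) V (by
        intro e f
        cases e <;> cases f
        · exact ⟨v, by simp [sel, hvi, hvV]⟩
        · exact ⟨u, by simp [sel, hui, hj hu]⟩
        · exact ⟨x, by simp [sel, hx, hxV]⟩
        · exact ⟨y, by simp [sel, hy, hyV]⟩)
      exact (mul_pos (hpos i) hV).ne' this
    obtain ⟨a, b, haj, hak, hbj, hbk, hab⟩ : ∃ a b : Fin 4, a ≠ j ∧ a ≠ k ∧ b ≠ j ∧ b ≠ k ∧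
        ∀ i, i = a ∨ i = b ∨ i = j ∨ i = k := by
      clear * - hjk
      revert j k
      decide
    have cov : ∀ x, x ∈ U a ∨ x ∈ U b ∨ x ∈ U j ∨ x ∈ U k := by
      intro x
      have hx : x ∈ ⋃ i, U i := hcover ▸ Set.mem_univ x
      obtain ⟨i, hi⟩ := Set.mem_iUnion.1 hx
      rcases hab i with h | h | h | h <;> subst h <;> simp [hi]
    have dak : ∀ x, x ∈ U a → x ∉ U k := fun x h => Set.disjoint_left.1 (hdisj a k hak) h
    have dbk : ∀ x, x ∈ U b → x ∉ U k := fun x h => Set.disjoint_left.1 (hdisj b k hbk) h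
    have djk : ∀ x, x ∈ U j → x ∉ U k := fun x h => Set.disjoint_left.1 (hdisj j k hjk) h
    have hk' : ∀ x, x ∈ V → x ∉ U k := fun x h => hk h
    have hj' : ∀ x, x ∈ U j → x ∈ V := fun x h => hj h
    rcases split a haj hak with ha | ha <;> rcases split b hbj hbk with hb | hb
    · exfalso
      apply nk
      ext x
      have := cov x
      simp only [Set.mem_compl_iff]
      clear * - this cov ha hb hk' hj'
      grind [Set.disjoint_left]
    · refine ⟨a, haj, hak, ?_⟩
      ext x
      have := cov x
      simp only [Set.mem_union]
      clear * - this cov ha hb hk' hj'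
      grind [Set.disjoint_left]
    · refine ⟨b, hbj, hbk, ?_⟩
      ext x
      have := cov x
      simp only [Set.mem_union]
      clear * - this cov ha hb hk' hj'
      grind [Set.disjoint_left]
    · exfalso
      apply nj
      ext x
      have := cov x
      clear * - this cov ha hb hk' hj'
      grind [Set.disjoint_left]
  obtain ⟨⟨e, f, g, hs1, hs2⟩, hn⟩ := hTmem
  simp only [Set.mem_insert_iff, Set.mem_singleton_iff, not_or] at hn
  obtain ⟨n1, n2, n3, n4⟩ := hn
  have hs := hs1.trans hs2
  obtain ⟨c, hcj, hck⟩ : ∃ c : Fin 4, c ≠ j ∧ c ≠ k := by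
    clear * -
    revert j k
    decide
  obtain ⟨u, hu⟩ := hne j
  obtain ⟨v, hv⟩ := hne k
  obtain ⟨w, hw⟩ := hne c
  have huk : u ∉ U k := Set.disjoint_left.1 (hdisj j k hjk) hu
  have hvj : v ∉ U j := fun h => Set.disjoint_left.1 (hdisj j k hjk) h hv
  have hwj : w ∉ U j := Set.disjoint_left.1 (hdisj c j hcj) hw
  have hwk : w ∉ U k := Set.disjoint_left.1 (hdisj c k hck) hw
  cases e <;> cases f <;> simp only [sel, if_true, if_false, Bool.false_eq_true] at hs hs1 hs2
  · exact absurd hv (hs hvj)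
  · exact absurd (hs hwj) hwk
  · cases g <;> simp only [if_true, if_false, Bool.false_eq_true] at hs1 hs2
    · obtain ⟨i, a, b, h⟩ := key Tᶜ ((h1 T).1 ▸ hT) hs1 hs2
        (fun h => n2 (by rw [← h, compl_compl])) (fun h => n3 (compl_injective h))
      exact ⟨i, a, b, Or.inr h⟩
    · obtain ⟨i, a, b, h⟩ := key T hT hs1 hs2 n1 n4
      exact ⟨i, a, b, Or.inl h⟩
  · exact absurd (hs hu) huk
end

section
/- Let t be a tree realization of some midpoints structure on X and let U_0, U_1, U_2, U_3 be pairwise disjoint nonempty subsets of X with union X and t(U_i) > 0 for every i ∈ [0,3]. Then the alternating sum τ = Σ_{j∈[0,3]} (−1)^j · t_{(U_j, U_{(j+1) mod 4})} satisfies τ = 4·t(U_0 ∪ U_3) − 4·t(U_2 ∪ U_3); consequently τ > 0 if and only if t(U_0 ∪ U_3) > 0, and τ < 0 if and only if t(U_2 ∪ U_3) > 0. -/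
open Classical

theorem aux_p1 {a b c d w : Prop} (cov : a ∨ b ∨ c ∨ d) (aw : a → w) (wb : w → ¬b)
    (cw : c → w) (dw : d → w) : w ↔ ¬b := by tauto

theorem aux_p2 {a b c d w : Prop} (cov : a ∨ b ∨ c ∨ d) (aw : a → w) (wb : w → ¬b)
    (cw : c → w) (dw : d → ¬w) : w ↔ a ∨ c := by tauto

theorem aux_p3 {a b c d w : Prop} (cov : a ∨ b ∨ c ∨ d) (aw : a → w) (wb : w → ¬b)
    (cw : c → ¬w) (dw : d → w) : w ↔ a ∨ d := by tauto

theorem aux_p4 {a b c d w : Prop} (cov : a ∨ b ∨ c ∨ d) (aw : a → w) (wb : w → ¬b)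
    (cw : c → ¬w) (dw : d → ¬w) : w ↔ a := by tauto

theorem aux_p5 {a b c d : Prop} (cov : a ∨ b ∨ c ∨ d) (ab : a → ¬b) (ad : a → ¬d)
    (bc : b → ¬c) (cd : c → ¬d) : ¬(a ∨ c) ↔ b ∨ d := by tauto

theorem aux_compat {X : Type*} {t : Set X → ℝ}
    (h2 : ∀ S T : Set X, (∀ e f : Bool, (sel S e ∩ sel T f).Nonempty) → t S * t T = 0)
    {S T : Set X} (hS : t S ≠ 0) (hT : t T ≠ 0) :
    S ⊆ T ∨ S ⊆ Tᶜ ∨ T ⊆ S ∨ Tᶜ ⊆ S := by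
  by_contra hcon
  simp only [not_or, Set.not_subset] at hcon
  obtain ⟨⟨a, ha, ha'⟩, ⟨b, hb, hb'⟩, ⟨c, hc, hc'⟩, ⟨d, hd, hd'⟩⟩ := hcon
  have h := h2 S T (by
    intro e f
    cases e <;> cases f
    · exact ⟨d, by simpa [sel] using hd', by simpa [sel] using hd⟩
    · exact ⟨c, by simpa [sel] using hc', by simpa [sel] using hc⟩
    · exact ⟨a, by simpa [sel] using ha, by simpa [sel] using ha'⟩
    · exact ⟨b, by simpa [sel] using hb, by simpa [sel] using hb'⟩)
  exact (mul_ne_zero hS hT) h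

theorem aux_tW_s9 {X : Type*} [Fintype X] {t : Set X → ℝ}
    (h1 : ∀ S : Set X, t S = t Sᶜ ∧ 0 ≤ t S)
    (h2 : ∀ S T : Set X, (∀ e f : Bool, (sel S e ∩ sel T f).Nonempty) → t S * t T = 0)
    (A B C D : Set X) (hA : A.Nonempty) (hB : B.Nonempty) (hC : C.Nonempty) (hD : D.Nonempty)
    (hAB : ∀ x ∈ A, x ∉ B) (hAC : ∀ x ∈ A, x ∉ C) (hAD : ∀ x ∈ A, x ∉ D)
    (hBC : ∀ x ∈ B, x ∉ C) (hBD : ∀ x ∈ B, x ∉ D) (hCD : ∀ x ∈ C, x ∉ D)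
    (hcov : ∀ x, x ∈ A ∨ x ∈ B ∨ x ∈ C ∨ x ∈ D)
    (tC : t C ≠ 0) (tD : t D ≠ 0) :
    tW t (ioo A B) = 2 * t (A ∪ C) + 2 * t (A ∪ D) := by
  obtain ⟨a, ha⟩ := hA
  obtain ⟨b, hb⟩ := hB
  obtain ⟨c, hc⟩ := hC
  obtain ⟨d, hd⟩ := hD
  have e1 : (A ∪ C)ᶜ = B ∪ D := by
    ext x; exact aux_p5 (hcov x) (hAB x) (hAD x) (hBC x) (hCD x)
  have e2 : (A ∪ D)ᶜ = B ∪ C := by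
    ext x; exact aux_p5 (by rcases hcov x with h | h | h | h <;> simp [h]) (hAB x) (hAC x) (hBD x)
      (fun h h' => hCD x h' h)
  have key : ∀ W : Set X, t W ≠ 0 → A ⊆ W → W ⊆ Bᶜ → W ≠ A → W ≠ Bᶜ →
      W = A ∪ C ∨ W = A ∪ D := by
    intro W hW hAW hWB hne1 hne2
    have hbW : b ∉ W := fun h => hWB h hb
    have haW := hAW ha
    have cC : C ⊆ W ∨ C ⊆ Wᶜ := by
      rcases aux_compat h2 tC hW with h | h | h | h
      · exact Or.inl h
      · exact Or.inr h
      · exact absurd (h haW) (hAC a ha)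
      · exact absurd (h hbW) (hBC b hb)
    have cD : D ⊆ W ∨ D ⊆ Wᶜ := by
      rcases aux_compat h2 tD hW with h | h | h | h
      · exact Or.inl h
      · exact Or.inr h
      · exact absurd (h haW) (hAD a ha)
      · exact absurd (h hbW) (hBD b hb)
    rcases cC with cC | cC <;> rcases cD with cD | cD
    · exfalso; apply hne2; ext x; exact aux_p1 (hcov x) (@hAW x) (@hWB x) (@cC x) (@cD x)
    · left; ext x; exact aux_p2 (hcov x) (@hAW x) (@hWB x) (@cC x) (@cD x)
    · right; ext x; exact aux_p3 (hcov x) (@hAW x) (@hWB x) (@cC x) (@cD x)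
    · exfalso; apply hne1; ext x; exact aux_p4 (hcov x) (@hAW x) (@hWB x) (@cC x) (@cD x)
  have hsub1 : A ∪ C ⊆ Bᶜ := by
    rintro x (h | h) h'
    · exact hAB x h h'
    · exact hBC x h' h
  have hsub2 : A ∪ D ⊆ Bᶜ := by
    rintro x (h | h) h'
    · exact hAB x h h'
    · exact hBD x h' h
  have hacd : d ∉ A ∪ C := by
    rintro (h | h)
    · exact hAD d h hd
    · exact hCD d h hd
  have hadc : c ∉ A ∪ D := by
    rintro (h | h)
    · exact hAC c h hc
    · exact hCD c hc h
  have hcA : c ∉ A := fun h => hAC c h hc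
  have hdA : d ∉ A := fun h => hAD d h hd
  have hcB : c ∉ B := fun h => hBC c h hc
  have hdB : d ∉ B := fun h => hBD d h hd
  have haB := hAB a ha
  have hbA : b ∉ A := fun h => hAB b h hb
  have hset : tW t (ioo A B)
      = ∑ᶠ V ∈ ({A ∪ C, (A ∪ C)ᶜ, A ∪ D, (A ∪ D)ᶜ} : Set (Set X)), t V := by
    unfold tW
    apply finsum_mem_inter_support_eq'
    intro V hV
    have hV : t V ≠ 0 := hV
    have hVc : t Vᶜ ≠ 0 := by rw [← (h1 V).1]; exact hV
    simp only [ioo, Set.mem_sdiff, Set.mem_insert_iff, Set.mem_singleton_iff, not_or]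
    constructor
    · rintro ⟨⟨e, f, g, hs, hs'⟩, n1, n2, n3, n4⟩
      have hef : e = true ∧ f = false := by
        have hh := hs.trans hs'
        have q1 := @hh a; have q2 := @hh c
        revert q1 q2
        have q3 := @hh b; revert q3
        cases e <;> cases f <;> simp [sel, *]
      obtain ⟨rfl, rfl⟩ := hef
      cases g
      · simp only [sel] at hs hs'
        have := key Vᶜ hVc (by simpa using hs) (by simpa using hs')
          (fun h => n2 (by rw [← h, compl_compl])) (fun h => n3 (compl_injective h))
        rcases this with h | h
        · right; left; rw [← h, compl_compl]
        · right; right; right; rw [← h, compl_compl]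
      · simp only [sel] at hs hs'
        have := key V hV (by simpa using hs) (by simpa using hs') n1 n4
        tauto
    · have main : ∀ E : Set X, A ⊆ E → E ⊆ Bᶜ → (c ∈ E ∧ d ∉ E ∨ c ∉ E ∧ d ∈ E) →
          (V = E ∨ V = Eᶜ) → V ∈ icc A B ∧ ¬V = A ∧ ¬V = Aᶜ ∧ ¬V = B ∧ ¬V = Bᶜ := by
        intro E hAE hEB hcd hVE
        refine ⟨?_, ?_, ?_, ?_, ?_⟩
        · rcases hVE with rfl | rfl
          · exact ⟨true, false, true, by simpa [sel] using hAE, by simpa [sel] using hEB⟩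
          · exact ⟨true, false, false, by simpa [sel] using hAE, by simpa [sel] using hEB⟩
        all_goals
          intro h
          have hc' : c ∈ V ↔ d ∈ V := by rw [h]; simp [hcA, hdA, hcB, hdB]
          rcases hVE with rfl | rfl
          · tauto
          · simp only [Set.mem_compl_iff] at hc'; tauto
      rintro (h | h | h | h)
      · exact main _ Set.subset_union_left hsub1 (Or.inl ⟨Or.inr hc, hacd⟩) (Or.inl h)
      · exact main _ Set.subset_union_left hsub1 (Or.inl ⟨Or.inr hc, hacd⟩) (Or.inr h)
      · exact main _ Set.subset_union_left hsub2 (Or.inr ⟨hadc, Or.inr hd⟩) (Or.inl h)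
      · exact main _ Set.subset_union_left hsub2 (Or.inr ⟨hadc, Or.inr hd⟩) (Or.inr h)
  have d1 : A ∪ C ≠ (A ∪ C)ᶜ := fun h => by
    have : a ∈ (A ∪ C)ᶜ := h ▸ Or.inl ha
    exact this (Or.inl ha)
  have d2 : A ∪ C ≠ A ∪ D := fun h => hadc (h ▸ Or.inr hc)
  have d3 : A ∪ C ≠ (A ∪ D)ᶜ := fun h => by
    have : a ∈ (A ∪ D)ᶜ := h ▸ Or.inl ha
    exact this (Or.inl ha)
  have d4 : (A ∪ C)ᶜ ≠ A ∪ D := fun h => d3 (by rw [← h, compl_compl])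
  have d5 : (A ∪ C)ᶜ ≠ (A ∪ D)ᶜ := fun h => d2 (compl_injective h)
  have d6 : A ∪ D ≠ (A ∪ D)ᶜ := fun h => by
    have : a ∈ (A ∪ D)ᶜ := h ▸ Or.inl ha
    exact this (Or.inl ha)
  rw [hset, finsum_mem_insert _ (by simp only [Set.mem_insert_iff, Set.mem_singleton_iff]; tauto)
      (Set.toFinite _),
    finsum_mem_insert _ (by simp only [Set.mem_insert_iff, Set.mem_singleton_iff]; tauto)
      (Set.toFinite _),
    finsum_mem_insert _ (by simp only [Set.mem_singleton_iff]; tauto)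
      (Set.toFinite _), finsum_mem_singleton, ← (h1 (A ∪ C)).1, ← (h1 (A ∪ D)).1]
  ring

/-- Let `t` be a tree realization of some midpoints structure on `X` and let
`U₀, U₁, U₂, U₃` be pairwise disjoint nonempty subsets partitioning `X` with
`t(Uᵢ) > 0` for all `i`. Then the alternating sum
`τ = Σ_{j∈[0,3]} (−1)ʲ t_{(Uⱼ, U_{(j+1) mod 4})}` equals
`4t(U₀ ∪ U₃) − 4t(U₂ ∪ U₃)`; consequently `τ > 0` iff `t(U₀ ∪ U₃) > 0` and
`τ < 0` iff `t(U₂ ∪ U₃) > 0`. -/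
theorem alternating_sum_eq {X : Type*} [Fintype X] [LinearOrder X]
    (m : X → X → Set X) (hm : IsMidpoints m)
    (t : Set X → ℝ) (ht : IsTreeRealization m t)
    (U : Fin 4 → Set X)
    (hdisj : ∀ i j, i ≠ j → Disjoint (U i) (U j))
    (hne : ∀ i, (U i).Nonempty)
    (hcover : (⋃ i, U i) = Set.univ)
    (hpos : ∀ i, 0 < t (U i)) :
    let τ : ℝ := ∑ j : Fin 4, (-1 : ℝ) ^ (j : ℕ) * tW t (ioo (U j) (U (j + 1)))
    τ = 4 * t (U 0 ∪ U 3) - 4 * t (U 2 ∪ U 3) ∧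
    (0 < τ ↔ 0 < t (U 0 ∪ U 3)) ∧
    (τ < 0 ↔ 0 < t (U 2 ∪ U 3)) := by
  obtain ⟨h1, h2, -⟩ := ht
  have hd : ∀ i j, i ≠ j → ∀ x ∈ U i, x ∉ U j :=
    fun i j hij x hx hx' => Set.disjoint_left.mp (hdisj i j hij) hx hx'
  have hcov : ∀ x, x ∈ U 0 ∨ x ∈ U 1 ∨ x ∈ U 2 ∨ x ∈ U 3 := by
    intro x
    have hx : x ∈ ⋃ i, U i := hcover ▸ Set.mem_univ x
    obtain ⟨i, hi⟩ := Set.mem_iUnion.mp hx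
    revert hi; clear * -; intro hi; fin_cases i
    · exact Or.inl hi
    · exact Or.inr (Or.inl hi)
    · exact Or.inr (Or.inr (Or.inl hi))
    · exact Or.inr (Or.inr (Or.inr hi))
  have hn : ∀ i, t (U i) ≠ 0 := fun i => (hpos i).ne'
  have L : ∀ i j k l : Fin 4, i ≠ j → i ≠ k → i ≠ l → j ≠ k → j ≠ l → k ≠ l →
      (∀ x, x ∈ U i ∨ x ∈ U j ∨ x ∈ U k ∨ x ∈ U l) →
      tW t (ioo (U i) (U j)) = 2 * t (U i ∪ U k) + 2 * t (U i ∪ U l) := by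
    intro i j k l a b c d e f hc
    exact aux_tW_s9 h1 h2 _ _ _ _ (hne i) (hne j) (hne k) (hne l) (hd _ _ a) (hd _ _ b) (hd _ _ c)
      (hd _ _ d) (hd _ _ e) (hd _ _ f) hc (hn k) (hn l)
  have L0 := L 0 1 2 3 (by decide) (by decide) (by decide) (by decide) (by decide) (by decide) hcov
  have L1 := L 1 2 3 0 (by decide) (by decide) (by decide) (by decide) (by decide) (by decide)
    (fun x => by have := hcov x; tauto)
  have L2 := L 2 3 0 1 (by decide) (by decide) (by decide) (by decide) (by decide) (by decide)
    (fun x => by have := hcov x; tauto)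
  have L3 := L 3 0 1 2 (by decide) (by decide) (by decide) (by decide) (by decide) (by decide)
    (fun x => by have := hcov x; tauto)
  have comp : ∀ i j k l : Fin 4, i ≠ k → i ≠ l → j ≠ k → j ≠ l →
      (∀ x, x ∈ U i ∨ x ∈ U j ∨ x ∈ U k ∨ x ∈ U l) → t (U i ∪ U j) = t (U k ∪ U l) := by
    intro i j k l a b c d hc
    rw [(h1 (U i ∪ U j)).1]
    congr 1
    ext x
    have := hc x; have := hd _ _ a x; have := hd _ _ b x
    have := hd _ _ c x; have := hd _ _ d x
    simp only [Set.mem_compl_iff, Set.mem_union]; tauto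
  have C1 := comp 1 3 2 0 (by decide) (by decide) (by decide) (by decide)
    (fun x => by have := hcov x; tauto)
  have C2 := comp 1 0 2 3 (by decide) (by decide) (by decide) (by decide)
    (fun x => by have := hcov x; tauto)
  have C3 := comp 2 1 0 3 (by decide) (by decide) (by decide) (by decide)
    (fun x => by have := hcov x; tauto)
  have hτ : (∑ j : Fin 4, (-1 : ℝ) ^ (j : ℕ) * tW t (ioo (U j) (U (j + 1))))
      = 4 * t (U 0 ∪ U 3) - 4 * t (U 2 ∪ U 3) := by
    have a0 : (0 + 1 : Fin 4) = 1 := rfl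
    have a1 : (1 + 1 : Fin 4) = 2 := rfl
    have a2 : (2 + 1 : Fin 4) = 3 := rfl
    have a3 : (3 + 1 : Fin 4) = 0 := rfl
    have v0 : ((0 : Fin 4) : ℕ) = 0 := rfl
    have v1 : ((1 : Fin 4) : ℕ) = 1 := rfl
    have v2 : ((2 : Fin 4) : ℕ) = 2 := rfl
    have v3 : ((3 : Fin 4) : ℕ) = 3 := rfl
    rw [Fin.sum_univ_four, a0, a1, a2, a3, v0, v1, v2, v3, L0, L1, L2, L3, C1, C2, C3,
      Set.union_comm (U 3) (U 1), C1, Set.union_comm (U 3) (U 2), Set.union_comm (U 0) (U 2)]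
    ring
  have hprod : t (U 0 ∪ U 3) * t (U 2 ∪ U 3) = 0 := by
    apply h2
    obtain ⟨x0, p0⟩ := hne 0
    obtain ⟨x1, p1⟩ := hne 1
    obtain ⟨x2, p2⟩ := hne 2
    obtain ⟨x3, p3⟩ := hne 3
    intro e f
    cases e <;> cases f
    · refine ⟨x1, ?_⟩
      simp [sel, hd 1 0 (by decide) _ p1, hd 1 2 (by decide) _ p1, hd 1 3 (by decide) _ p1]
    · refine ⟨x2, ?_⟩
      simp [sel, p2, hd 2 0 (by decide) _ p2, hd 2 3 (by decide) _ p2]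
    · refine ⟨x0, ?_⟩
      simp [sel, p0, hd 0 2 (by decide) _ p0, hd 0 3 (by decide) _ p0]
    · refine ⟨x3, ?_⟩
      simp [sel, p3]
  have n1 := (h1 (U 0 ∪ U 3)).2
  have n2 := (h1 (U 2 ∪ U 3)).2
  intro τ
  have hτ' : τ = 4 * t (U 0 ∪ U 3) - 4 * t (U 2 ∪ U 3) := hτ
  refine ⟨hτ', ?_, ?_⟩ <;> rw [hτ'] <;> rcases mul_eq_zero.mp hprod with h | h <;>
    rw [h] at * <;> constructor <;> intro h' <;> linarith
end

section
/- For any tree realization t of a midpoints structure m on X and any x ≠ y in X, the edge containing the midpoint has positive length: t(m{x,y}) > 0. -/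
open Classical

/-- For any tree realization `t` of a midpoints structure `m` on `X` and any
`x ≠ y` in `X`, the edge containing the midpoint has positive length:
`t(m{x,y}) > 0`. -/
theorem midpoint_edge_positive {X : Type*} [Fintype X] [LinearOrder X]
    (m : X → X → Set X) (hm : IsMidpoints m)
    (t : Set X → ℝ) (ht : IsTreeRealization m t)
    (x y : X) (hxy : x ≠ y) :
    0 < t (m x y) := by
  obtain ⟨h1, -, h3⟩ := ht
  rcases (h1 (m x y)).2.lt_or_eq with h | h
  · exact h
  exfalso
  have key : ∀ z : X, tW t (ico {z} (m x y)) = tW t (icc {z} (m x y)) := by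
    intro z
    unfold tW
    apply finsum_mem_inter_support_eq'
    intro U hU
    have hne : U ≠ m x y := by
      rintro rfl
      exact hU h.symm
    simp [ico, hne]
  have a := h3 x y hxy
  have b := h3 y x hxy.symm
  rw [hm.1 y x] at b
  rw [key] at a b
  exact lt_asymm a b
end
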